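/- arXiv:2102.00470 — 2 statements merged into one kernel-verified Lean document; each statement's English description precedes it below -/
import Mathlib

section
/- Let H : ℝ × ℝ × ℝ → ℝ be smooth, 1-periodic in the first (time) and second (position) variables, with 1/C < ∂²H/∂p² < C everywhere for some constant C > 0, and such that H(t, x, p) = p²/(2D) whenever |p| ≥ M, for some constants D > 0 and M > 0. Let Φ : ℝ × ℝ × ℝ² → ℝ² be a smooth complete flow of Hamilton's equations for H (Φ(s, s, q) = q, and t ↦ Φ(s, t, q) solves ẋ = ∂_p H, ṗ = −∂_x H). Then the time-1 map Φ(0, 1, ·) lies in 𝒫¹: there exist n ∈ ℕ and real numbers 0 = ε₀ < ε₁ < ⋯ < εₙ = 1 such that each map Φ(εᵢ, εᵢ₊₁, ·) : ℝ² → ℝ² is a lift of a positive monotone twist map of the cylinder, and Φ(0, 1, ·) = Φ(ε_{n−1}, εₙ, ·) ∘ ⋯ ∘ Φ(ε₀, ε₁, ·). -/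
open Filter Topology

noncomputable section

abbrev V2 : Type := ℝ × ℝ

/-- The unit translation `T(x, y) = (x+1, y)` of the lifted cylinder. -/
def Tmap : V2 → V2 := fun p => (p.1 + 1, p.2)

/-- A lift of a positive monotone twist map of the cylinder: a C¹ diffeomorphism of ℝ²
commuting with `T`, isotopic to the identity (through homeomorphisms of the cylinder),
with everywhere positive twist `∂X/∂y > 0`, and exact symplectic. -/
def IsPosTwistLift (φ : V2 → V2) : Prop :=
  ContDiff ℝ 1 φ ∧ Function.Bijective φ ∧ ContDiff ℝ 1 (Function.invFun φ) ∧
  (∀ p, φ (Tmap p) = Tmap (φ p)) ∧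
  (∃ H : ℝ → V2 → V2, Continuous (fun q : ℝ × V2 => H q.1 q.2) ∧
    H 0 = id ∧ H 1 = φ ∧
    ∀ t, IsHomeomorph (H t) ∧ ∀ p, H t (Tmap p) = Tmap (H t p)) ∧
  (∀ p, 0 < fderiv ℝ (fun q => (φ q).1) p (0, 1)) ∧
  (∃ S : V2 → ℝ, ContDiff ℝ 1 S ∧ (∀ p, S (Tmap p) = S p) ∧
    ∀ p, fderiv ℝ S p (1, 0) = (φ p).2 * fderiv ℝ (fun q => (φ q).1) p (1, 0) - p.2 ∧
      fderiv ℝ S p (0, 1) = (φ p).2 * fderiv ℝ (fun q => (φ q).1) p (0, 1))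

/-- `φ ∈ 𝒫¹`: `φ` is a finite composition of lifts of positive monotone twist maps. -/
def MemP1 (φ : V2 → V2) : Prop :=
  ∃ l : List (V2 → V2), l ≠ [] ∧ (∀ f ∈ l, IsPosTwistLift f) ∧
    φ = l.foldr (· ∘ ·) id

/-- Composition `Φ(ε_{k-1}, ε_k, ·) ∘ ⋯ ∘ Φ(ε₀, ε₁, ·)` of the time-step maps of a flow. -/
def compFlow (Φ : ℝ → ℝ → V2 → V2) (ε : ℕ → ℝ) : ℕ → (V2 → V2)
  | 0 => id
  | k + 1 => (Φ (ε k) (ε (k + 1))) ∘ compFlow Φ ε k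

theorem two_le_infty : (2 : WithTop ℕ∞) ≤ ((⊤ : ℕ∞) : WithTop ℕ∞) :=
  WithTop.coe_le_coe.2 (le_top (a := (2 : ℕ∞)))

section Calculus

variable {E F : Type*} [NormedAddCommGroup E] [NormedSpace ℝ E] [NormedAddCommGroup F]
  [NormedSpace ℝ F]

/-- Global solutions of an ODE with a `C¹` time-dependent right-hand side are determined by
their value at one time. -/
theorem ODE_solution_unique_of_contDiff [ProperSpace E] {V : ℝ → E → E}
    (hV : ContDiff ℝ 1 (fun z : ℝ × E => V z.1 z.2)) {f g : ℝ → E} {t₀ : ℝ}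
    (hf : ∀ t, HasDerivAt f (V t (f t)) t) (hg : ∀ t, HasDerivAt g (V t (g t)) t)
    (heq : f t₀ = g t₀) : f = g := by
  ext1 t
  obtain ⟨a, b, ht, ht₀⟩ : ∃ a b, t ∈ Set.Ioo a b ∧ t₀ ∈ Set.Ioo a b := by
    refine ⟨min t t₀ - 1, max t t₀ + 1, ?_, ?_⟩ <;> grind
  have hfc : Continuous f := continuous_iff_continuousAt.2 fun t => (hf t).continuousAt
  have hgc : Continuous g := continuous_iff_continuousAt.2 fun t => (hg t).continuousAt
  obtain ⟨R, hR⟩ := ((isCompact_Icc (a := a) (b := b)).image hfc).isBounded.union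
    ((isCompact_Icc (a := a) (b := b)).image hgc).isBounded |>.subset_closedBall 0
  obtain ⟨K, hK⟩ := ContDiffOn.exists_lipschitzOnWith (hV.contDiffOn
      (s := Set.Icc a b ×ˢ Metric.closedBall (0 : E) R)) one_ne_zero
    ((convex_Icc a b).prod (convex_closedBall 0 R))
    (isCompact_Icc.prod (isCompact_closedBall 0 R))
  refine ODE_solution_unique_of_mem_Ioo (s := fun _ => Metric.closedBall (0 : E) R) (K := K)
    (fun u hu x hx y hy => ?_) ht₀
    (fun u hu => ⟨hf u, hR (Or.inl ⟨u, Set.Ioo_subset_Icc_self hu, rfl⟩)⟩)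
    (fun u hu => ⟨hg u, hR (Or.inr ⟨u, Set.Ioo_subset_Icc_self hu, rfl⟩)⟩) heq ht
  have := hK (x := (u, x)) ⟨Set.Ioo_subset_Icc_self hu, hx⟩ (y := (u, y))
    ⟨Set.Ioo_subset_Icc_self hu, hy⟩
  simpa [Prod.edist_eq] using this

/-- Differentiation under the integral sign for a `C¹` integrand. -/
theorem hasFDerivAt_intervalIntegral_of_contDiff [ProperSpace E] {f : ℝ × E → F}
    (hf : ContDiff ℝ 1 f) (a b : ℝ) (x : E) :
    HasFDerivAt (fun x => ∫ u in a..b, f (u, x))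
      (∫ u in a..b, (fderiv ℝ f (u, x)).comp (ContinuousLinearMap.inr ℝ ℝ E)) x := by
  have hc : Continuous fun z : ℝ × E =>
      (fderiv ℝ f z).comp (ContinuousLinearMap.inr ℝ ℝ E) :=
    (hf.continuous_fderiv one_ne_zero).clm_comp continuous_const
  obtain ⟨B, hB⟩ := ((isCompact_uIcc (a := a) (b := b)).prod
    (isCompact_closedBall x 1)).exists_bound_of_continuousOn hc.continuousOn
  refine intervalIntegral.hasFDerivAt_integral_of_dominated_of_fderiv_le
    (F' := fun x u => (fderiv ℝ f (u, x)).comp (ContinuousLinearMap.inr ℝ ℝ E))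
    (bound := fun _ => B) (Metric.closedBall_mem_nhds x one_pos)
    (Eventually.of_forall fun y => ?_) ?_ ?_
    (Eventually.of_forall fun u hu y hy => hB (u, y) ⟨Set.uIoc_subset_uIcc hu, hy⟩)
    intervalIntegrable_const (Eventually.of_forall fun u _ y _ => ?_)
  · exact (hf.continuous.comp (by fun_prop : Continuous fun u : ℝ => (u, y))).aestronglyMeasurable
  · exact (hf.continuous.comp (by fun_prop : Continuous fun u : ℝ => (u, x))).intervalIntegrable _ _
  · exact (hc.comp (by fun_prop : Continuous fun u : ℝ => (u, x))).aestronglyMeasurable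
  · exact ((hf.differentiable one_ne_zero (u, y)).hasFDerivAt).comp y (hasFDerivAt_prodMk_right u y)

theorem DifferentiableAt.hasDerivAt_comp_curve {f : E → F} {c : ℝ → E} {c' : E} {t : ℝ}
    (hf : DifferentiableAt ℝ f (c t)) (hc : HasDerivAt c c' t) :
    HasDerivAt (fun u => f (c u)) (fderiv ℝ f (c t) c') t :=
  hf.hasFDerivAt.comp_hasDerivAt t hc

theorem fderiv_fderiv_apply_comm {f : E → F} (hf : ContDiff ℝ 2 f) (z v w : E) :
    fderiv ℝ (fun z => fderiv ℝ f z v) z w = fderiv ℝ (fun z => fderiv ℝ f z w) z v := by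
  have hd : DifferentiableAt ℝ (fderiv ℝ f) z :=
    (hf.fderiv_right (m := 1) (by norm_num)).differentiable one_ne_zero z
  rw [fderiv_clm_apply hd (by fun_prop), fderiv_clm_apply hd (by fun_prop)]
  simpa using (hf.contDiffAt.isSymmSndFDerivAt (by simp)).eq w v

/-- Let `X, P, h` be functions of time and of the initial condition satisfying
`dh = Ẋ dP - Ṗ dX` in the initial condition. Then the action `∫ (P Ẋ - h)` has differential
`P dX` taken between the two end times. -/
theorem hasFDerivAt_action [ProperSpace E] {X P h : ℝ × E → ℝ} (hX : ContDiff ℝ 2 X)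
    (hP : ContDiff ℝ 1 P) (hh : ContDiff ℝ 1 h)
    (hHam : ∀ z v, fderiv ℝ h z (0, v) =
      fderiv ℝ X z (1, 0) * fderiv ℝ P z (0, v) - fderiv ℝ P z (1, 0) * fderiv ℝ X z (0, v))
    (a b : ℝ) (x : E) :
    HasFDerivAt (fun x => ∫ u in a..b, (P (u, x) * fderiv ℝ X (u, x) (1, 0) - h (u, x)))
      (P (b, x) • (fderiv ℝ X (b, x)).comp (ContinuousLinearMap.inr ℝ ℝ E) -
        P (a, x) • (fderiv ℝ X (a, x)).comp (ContinuousLinearMap.inr ℝ ℝ E)) x := by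
  have hdX : ContDiff ℝ 1 (fderiv ℝ X) := hX.fderiv_right (by norm_num)
  have hXt : ContDiff ℝ 1 fun z => fderiv ℝ X z (1, 0) := hdX.clm_apply contDiff_const
  have hL : ContDiff ℝ 1 fun z => P z * fderiv ℝ X z (1, 0) - h z := (hP.mul hXt).sub hh
  have hLc : Continuous fun u => (fderiv ℝ (fun z => P z * fderiv ℝ X z (1, 0) - h z)
      (u, x)).comp (ContinuousLinearMap.inr ℝ ℝ E) :=
    ((hL.continuous_fderiv one_ne_zero).comp (by fun_prop : Continuous fun u : ℝ => (u, x))).clm_comp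
      continuous_const
  refine (hasFDerivAt_intervalIntegral_of_contDiff hL a b x).congr_fderiv
    (intervalIntegral.integral_eq_sub_of_hasDerivAt
    (f := fun u => P (u, x) • (fderiv ℝ X (u, x)).comp (ContinuousLinearMap.inr ℝ ℝ E))
    (fun u _ => ?_) (hLc.intervalIntegrable _ _))
  have hu : HasDerivAt (fun u : ℝ => (u, x)) ((1 : ℝ), (0 : E)) u :=
    (hasDerivAt_id u).prodMk (hasDerivAt_const u x)
  have hPd := (hP.differentiable one_ne_zero (u, x)).hasFDerivAt
  have hhd := (hh.differentiable one_ne_zero (u, x)).hasFDerivAt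
  have hXd := (hdX.differentiable one_ne_zero (u, x)).hasFDerivAt
  have hXtd := (hXt.differentiable one_ne_zero (u, x)).hasFDerivAt
  have h1 := hPd.comp_hasDerivAt u hu
  have h2 : HasDerivAt (fun u => (fderiv ℝ X (u, x)).comp (ContinuousLinearMap.inr ℝ ℝ E))
      ((fderiv ℝ (fderiv ℝ X) (u, x) (1, 0)).comp (ContinuousLinearMap.inr ℝ ℝ E)) u :=
    ((ContinuousLinearMap.compL ℝ E (ℝ × E) ℝ).flip
      (ContinuousLinearMap.inr ℝ ℝ E)).hasFDerivAt.comp_hasDerivAt u (hXd.comp_hasDerivAt u hu)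
  refine (h1.smul h2).congr_deriv ?_
  rw [show fderiv ℝ (fun z => P z * fderiv ℝ X z (1, 0) - h z) (u, x) = _ from
    ((hPd.mul hXtd).sub hhd).fderiv]
  ext v
  have key := fderiv_fderiv_apply_comm hX (u, x) (1, 0) (0, v)
  rw [fderiv_clm_apply hXd.differentiableAt (by fun_prop) (x := (u, x)) (u := fun _ => (0, v))] at key
  simp at key
  simp [hHam, key]
  ring

end Calculus

/-- The Hamiltonian vector field `(∂_p H, -∂_x H)`. -/
def hamiltonianField (H : ℝ → ℝ → ℝ → ℝ) (t : ℝ) (q : V2) : V2 :=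
  (deriv (H t q.1) q.2, -(deriv (fun x => H t x q.2) q.1))

/-- `Φ` is a smooth complete flow of Hamilton's equations for the smooth Hamiltonian `H`. -/
structure IsHamiltonianFlow (H : ℝ → ℝ → ℝ → ℝ) (Φ : ℝ → ℝ → V2 → V2) : Prop where
  contDiff_ham : ContDiff ℝ (⊤ : ℕ∞) (fun q : ℝ × ℝ × ℝ => H q.1 q.2.1 q.2.2)
  contDiff_flow : ContDiff ℝ (⊤ : ℕ∞) (fun q : ℝ × ℝ × V2 => Φ q.1 q.2.1 q.2.2)
  flow_self : ∀ s q, Φ s s q = q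
  hasDerivAt : ∀ s q t, HasDerivAt (fun u => Φ s u q) (hamiltonianField H t (Φ s t q)) t

namespace IsHamiltonianFlow

variable {H : ℝ → ℝ → ℝ → ℝ} {Φ : ℝ → ℝ → V2 → V2} (h : IsHamiltonianFlow H Φ)
include h

theorem differentiable_ham : Differentiable ℝ (fun q : ℝ × ℝ × ℝ => H q.1 q.2.1 q.2.2) :=
  h.contDiff_ham.differentiable (by simp)

theorem deriv_momentum (t x p : ℝ) : deriv (H t x) p =
    fderiv ℝ (fun q : ℝ × ℝ × ℝ => H q.1 q.2.1 q.2.2) (t, x, p) (0, 0, 1) :=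
  (DifferentiableAt.hasDerivAt_comp_curve (c := fun p => (t, x, p)) (h.differentiable_ham _)
    ((hasDerivAt_const p t).prodMk ((hasDerivAt_const p x).prodMk (hasDerivAt_id p)))).deriv

theorem deriv_position (t x p : ℝ) : deriv (fun x => H t x p) x =
    fderiv ℝ (fun q : ℝ × ℝ × ℝ => H q.1 q.2.1 q.2.2) (t, x, p) (0, 1, 0) :=
  (DifferentiableAt.hasDerivAt_comp_curve (c := fun x => (t, x, p)) (h.differentiable_ham _)
    ((hasDerivAt_const x t).prodMk ((hasDerivAt_id x).prodMk (hasDerivAt_const x p)))).deriv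

theorem hasDerivAt_fst (s : ℝ) (q : V2) (t : ℝ) :
    HasDerivAt (fun u => (Φ s u q).1) (deriv (H t (Φ s t q).1) (Φ s t q).2) t :=
  (ContinuousLinearMap.fst ℝ ℝ ℝ).hasFDerivAt.comp_hasDerivAt t (h.hasDerivAt s q t)

theorem hasDerivAt_snd (s : ℝ) (q : V2) (t : ℝ) :
    HasDerivAt (fun u => (Φ s u q).2) (-deriv (fun x => H t x (Φ s t q).2) (Φ s t q).1) t :=
  (ContinuousLinearMap.snd ℝ ℝ ℝ).hasFDerivAt.comp_hasDerivAt t (h.hasDerivAt s q t)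

theorem contDiff_field :
    ContDiff ℝ (⊤ : ℕ∞) (fun z : ℝ × V2 => hamiltonianField H z.1 z.2) := by
  have hd : ContDiff ℝ (⊤ : ℕ∞) (fderiv ℝ (fun q : ℝ × ℝ × ℝ => H q.1 q.2.1 q.2.2)) :=
    h.contDiff_ham.fderiv_right (by simp)
  simp only [hamiltonianField, h.deriv_momentum, h.deriv_position]
  exact (hd.clm_apply contDiff_const).prodMk (hd.clm_apply contDiff_const).neg

theorem eq_flow {g : ℝ → V2} (hg : ∀ t, HasDerivAt g (hamiltonianField H t (g t)) t)
    (s r t : ℝ) {q : V2} (hq : g r = Φ s r q) : g t = Φ s t q :=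
  congrFun (ODE_solution_unique_of_contDiff (h.contDiff_field.of_le (by simp)) hg
    (h.hasDerivAt s q) hq) t

theorem flow_flow (s t u : ℝ) (q : V2) : Φ t u (Φ s t q) = Φ s u q :=
  h.eq_flow (h.hasDerivAt t (Φ s t q)) s t u (h.flow_self t _)

theorem contDiff_timeMap (s t : ℝ) : ContDiff ℝ (⊤ : ℕ∞) (Φ s t) :=
  h.contDiff_flow.comp (by fun_prop : ContDiff ℝ (⊤ : ℕ∞) fun q : V2 => (s, t, q))

theorem leftInverse (s t : ℝ) : Function.LeftInverse (Φ t s) (Φ s t) := fun q => by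
  rw [h.flow_flow, h.flow_self]

theorem isHomeomorph (s t : ℝ) : IsHomeomorph (Φ s t) :=
  isHomeomorph_iff_exists_inverse.2 ⟨(h.contDiff_timeMap s t).continuous, Φ t s,
    h.leftInverse s t, h.leftInverse t s, (h.contDiff_timeMap t s).continuous⟩

theorem invFun_eq (s t : ℝ) : Function.invFun (Φ s t) = Φ t s :=
  funext fun q => (h.leftInverse s t).injective <| by
    rw [Function.invFun_eq ⟨Φ t s q, h.leftInverse t s q⟩, h.leftInverse t s q]

theorem flow_Tmap (hper : ∀ t x p, H t (x + 1) p = H t x p) (s t : ℝ) (q : V2) :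
    Φ s t (Tmap q) = Tmap (Φ s t q) := by
  refine (h.eq_flow (g := fun u => Tmap (Φ s u q)) (fun u => ?_) s s t ?_).symm
  · have hfield : hamiltonianField H u (Tmap (Φ s u q)) = hamiltonianField H u (Φ s u q) := by
      have h1 : H u ((Φ s u q).1 + 1) = H u (Φ s u q).1 := funext fun p => hper u _ p
      have h2 : (fun x => H u x (Φ s u q).2) = fun x => H u (x + 1) (Φ s u q).2 :=
        funext fun x => (hper u x _).symm
      simp only [hamiltonianField, Tmap, h1]
      conv_rhs => rw [h2]
      rw [deriv_comp_add_const (f := fun x => H u x (Φ s u q).2)]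
    rw [hfield]
    exact (h.hasDerivAt s q u).add_const ((1 : ℝ), (0 : ℝ)) |>.congr_of_eventuallyEq
      (Filter.Eventually.of_forall fun u => by simp [Tmap, Prod.ext_iff])
  · simp [h.flow_self]

/-- The time maps of a Hamiltonian flow are exact symplectic: the generating function is the
action. -/
theorem exists_generating (hper : ∀ t x p, H t (x + 1) p = H t x p) (s t : ℝ) :
    ∃ S : V2 → ℝ, ContDiff ℝ 1 S ∧ (∀ p, S (Tmap p) = S p) ∧
      ∀ p, fderiv ℝ S p (1, 0) =
          (Φ s t p).2 * fderiv ℝ (fun q => (Φ s t q).1) p (1, 0) - p.2 ∧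
        fderiv ℝ S p (0, 1) = (Φ s t p).2 * fderiv ℝ (fun q => (Φ s t q).1) p (0, 1) := by
  have hF : ContDiff ℝ (⊤ : ℕ∞) fun z : ℝ × V2 => Φ s z.1 z.2 :=
    h.contDiff_flow.comp (by fun_prop : ContDiff ℝ (⊤ : ℕ∞) fun z : ℝ × V2 => (s, z.1, z.2))
  set X : ℝ × V2 → ℝ := fun z => (Φ s z.1 z.2).1 with hX_def
  set P : ℝ × V2 → ℝ := fun z => (Φ s z.1 z.2).2 with hP_def
  have hX : ContDiff ℝ (⊤ : ℕ∞) X := hF.fst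
  have hP : ContDiff ℝ (⊤ : ℕ∞) P := hF.snd
  have hXd : Differentiable ℝ X := hX.differentiable (by simp)
  have hPd : Differentiable ℝ P := hP.differentiable (by simp)
  have htime (z : ℝ × V2) : HasDerivAt (fun u => (u, z.2)) ((1 : ℝ), (0 : V2)) z.1 :=
    (hasDerivAt_id _).prodMk (hasDerivAt_const _ _)
  have hXt (z : ℝ × V2) : fderiv ℝ X z (1, 0) = deriv (H z.1 (X z)) (P z) :=
    ((hXd z).hasDerivAt_comp_curve (htime z)).unique (h.hasDerivAt_fst s z.2 z.1)
  have hPt (z : ℝ × V2) : fderiv ℝ P z (1, 0) = -deriv (fun x => H z.1 x (P z)) (X z) :=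
    ((hPd z).hasDerivAt_comp_curve (htime z)).unique (h.hasDerivAt_snd s z.2 z.1)
  have hHam (z : ℝ × V2) (v : V2) :
      fderiv ℝ (fun z : ℝ × V2 => H z.1 (X z) (P z)) z (0, v) =
        fderiv ℝ X z (1, 0) * fderiv ℝ P z (0, v) - fderiv ℝ P z (1, 0) * fderiv ℝ X z (0, v) := by
    have hc := (h.differentiable_ham (z.1, X z, P z)).hasFDerivAt.comp z
      (hasFDerivAt_fst.prodMk ((hXd z).hasFDerivAt.prodMk (hPd z).hasFDerivAt))
    rw [show fderiv ℝ (fun z : ℝ × V2 => H z.1 (X z) (P z)) z = _ from hc.fderiv, hXt, hPt,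
      h.deriv_momentum, h.deriv_position]
    have hv (L : ℝ × ℝ × ℝ →L[ℝ] ℝ) (a b : ℝ) :
        L (0, a, b) = a * L (0, 1, 0) + b * L (0, 0, 1) := by
      have hab : ((0 : ℝ), a, b) = a • ((0 : ℝ), (1 : ℝ), (0 : ℝ)) + b • (0, 0, 1) := by simp
      rw [hab, map_add, map_smul, map_smul, smul_eq_mul, smul_eq_mul]
    refine (hv _ (fderiv ℝ X z (0, v)) (fderiv ℝ P z (0, v))).trans ?_
    ring
  have hS := hasFDerivAt_action (hX.of_le two_le_infty) (hP.of_le (by simp))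
    ((h.contDiff_ham.comp (contDiff_fst.prodMk (hX.prodMk hP))).of_le (by simp)) hHam s t
  have hfd (u : ℝ) (q : V2) : (fderiv ℝ X (u, q)).comp (ContinuousLinearMap.inr ℝ ℝ V2) =
      fderiv ℝ (fun q => (Φ s u q).1) q :=
    ((hXd (u, q)).hasFDerivAt.comp q (hasFDerivAt_prodMk_right u q)).fderiv.symm
  have hXs (q : V2) : fderiv ℝ (fun q => (Φ s s q).1) q = ContinuousLinearMap.fst ℝ ℝ ℝ := by
    have : (fun q => (Φ s s q).1) = Prod.fst := funext fun q => by rw [h.flow_self]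
    rw [this, fderiv_fst]
  have hX1 : Continuous (fderiv ℝ (fun q => (Φ s t q).1)) :=
    (h.contDiff_timeMap s t).fst.continuous_fderiv (by simp)
  simp only [hfd, hXs] at hS
  refine ⟨_, contDiff_one_iff_fderiv.2 ⟨fun q => (hS q).differentiableAt, ?_⟩, fun q => ?_,
    fun q => ?_⟩
  · rw [funext fun q => (hS q).fderiv]
    simp only [hP_def, h.flow_self]
    exact ((h.contDiff_timeMap s t).continuous.snd.smul hX1).sub
      (continuous_snd.smul continuous_const)
  · have hXT (u : ℝ) : X (u, Tmap q) = X (u, q) + 1 := by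
      simp only [hX_def, h.flow_Tmap hper]
      rfl
    have hPT (u : ℝ) : P (u, Tmap q) = P (u, q) := by
      simp only [hP_def, h.flow_Tmap hper]
      rfl
    have hHT (u x : ℝ) : H u (x + 1) = H u x := funext fun p => hper u x p
    simp only [Function.comp_def, hXt, hXT, hPT, hHT]
  · rw [(hS q).fderiv]
    simp [hP_def, h.flow_self]

/-- Where the Hamiltonian is `p² / (2D)`, the flow is the integrable shear. -/
theorem flow_of_quadratic {D M : ℝ}
    (hquad : ∀ t x p, M ≤ |p| → H t x p = p ^ 2 / (2 * D)) (s t : ℝ) {q : V2} (hq : M < |q.2|) :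
    Φ s t q = (q.1 + (t - s) * (q.2 / D), q.2) := by
  refine (h.eq_flow (g := fun u => (q.1 + (u - s) * (q.2 / D), q.2)) (fun u => ?_) s s t ?_).symm
  · have h1 (x : ℝ) : deriv (H u x) q.2 = q.2 / D := by
      have hev : H u x =ᶠ[𝓝 q.2] fun p => p ^ 2 / (2 * D) := by
        filter_upwards [continuous_abs.continuousAt.eventually_const_lt hq] with p hp
        exact hquad u x p hp.le
      rw [hev.deriv_eq]
      simp
      ring
    have h2 (x : ℝ) : deriv (fun x => H u x q.2) x = 0 := by
      simp [fun x => hquad u x q.2 hq.le]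
    simp only [hamiltonianField, h1, h2, neg_zero]
    refine HasDerivAt.prodMk ?_ (hasDerivAt_const _ _)
    simpa using (((hasDerivAt_id u).sub_const s).mul_const (q.2 / D)).const_add q.1
  · simp [h.flow_self]

/-- The twist `∂X/∂y` of the time maps, as a derivative of the full flow. -/
theorem fderiv_timeMap_fst (s t : ℝ) (q v : V2) :
    fderiv ℝ (fun q => (Φ s t q).1) q v =
      fderiv ℝ (fun z : ℝ × ℝ × V2 => (Φ z.1 z.2.1 z.2.2).1) (s, t, q) (0, 0, v) := by
  have hd := HasFDerivAt.comp (f := fun q => (s, t, q)) q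
    (h.contDiff_flow.fst.differentiable (by simp) (s, t, q)).hasFDerivAt
    ((hasFDerivAt_const s q).prodMk ((hasFDerivAt_const t q).prodMk (hasFDerivAt_id q)))
  rw [show fderiv ℝ (fun q => (Φ s t q).1) q = _ from hd.fderiv]
  simp

/-- At coinciding times, the time derivative of the twist is `∂²H/∂p²`. -/
theorem fderiv_twist_diagonal (s : ℝ) (q : V2) :
    fderiv ℝ (fun z => fderiv ℝ (fun z : ℝ × ℝ × V2 => (Φ z.1 z.2.1 z.2.2).1) z (0, 0, 0, 1))
      (s, s, q) (0, 1, 0) = deriv (deriv (H s q.1)) q.2 := by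
  rw [fderiv_fderiv_apply_comm (h.contDiff_flow.fst.of_le two_le_infty)]
  have ht : (fun z => fderiv ℝ (fun z : ℝ × ℝ × V2 => (Φ z.1 z.2.1 z.2.2).1) z (0, 1, 0)) =
      fun z : ℝ × ℝ × V2 => (hamiltonianField H z.2.1 (Φ z.1 z.2.1 z.2.2)).1 := by
    ext z
    exact (DifferentiableAt.hasDerivAt_comp_curve (c := fun t => (z.1, t, z.2.2))
      (h.contDiff_flow.fst.differentiable (by simp) _)
      ((hasDerivAt_const z.2.1 z.1).prodMk ((hasDerivAt_id z.2.1).prodMk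
        (hasDerivAt_const z.2.1 z.2.2)))).unique (h.hasDerivAt_fst z.1 z.2.2 z.2.1)
  have hc : ContDiff ℝ (⊤ : ℕ∞)
      fun z : ℝ × ℝ × V2 => (hamiltonianField H z.2.1 (Φ z.1 z.2.1 z.2.2)).1 :=
    (h.contDiff_field.comp ((by fun_prop : ContDiff ℝ (⊤ : ℕ∞) fun z : ℝ × ℝ × V2 => z.2.1).prodMk
      h.contDiff_flow)).fst
  rw [ht, ← (DifferentiableAt.hasDerivAt_comp_curve (c := fun y => (s, s, q.1, y))
    (hc.differentiable (by simp) _)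
    ((hasDerivAt_const q.2 s).prodMk ((hasDerivAt_const q.2 s).prodMk
      ((hasDerivAt_const q.2 q.1).prodMk (hasDerivAt_id q.2))))).deriv]
  simp [h.flow_self, hamiltonianField]

/-- A fibrewise convex Hamiltonian that is `p² / (2D)` near infinity has short time maps with
positive twist. -/
theorem exists_twist_pos (hper : ∀ t x p, H t (x + 1) p = H t x p)
    (hconv : ∀ t x p, 0 < deriv (deriv (H t x)) p) {D M : ℝ} (hD : 0 < D)
    (hquad : ∀ t x p, M ≤ |p| → H t x p = p ^ 2 / (2 * D)) :
    ∃ δ > 0, ∀ s ∈ Set.Icc (0 : ℝ) 1, ∀ t, s < t → t < s + δ → ∀ q,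
      0 < fderiv ℝ (fun q => (Φ s t q).1) q (0, 1) := by
  set tw : ℝ × ℝ × V2 → ℝ := fun z =>
    fderiv ℝ (fun z : ℝ × ℝ × V2 => (Φ z.1 z.2.1 z.2.2).1) z (0, 0, 0, 1) with htw
  have htwist (s t : ℝ) (q : V2) : fderiv ℝ (fun q => (Φ s t q).1) q (0, 1) = tw (s, t, q) :=
    h.fderiv_timeMap_fst s t q (0, 1)
  have htws : ContDiff ℝ (⊤ : ℕ∞) tw :=
    (h.contDiff_flow.fst.fderiv_right (by simp)).clm_apply contDiff_const
  have hcont : Continuous fun z => fderiv ℝ tw z (0, 1, 0) :=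
    (htws.continuous_fderiv (by simp)).clm_apply continuous_const
  obtain ⟨δ, hδ, hsub⟩ := ((isCompact_Icc (a := (0 : ℝ)) (b := 1)).prod
    ((isCompact_Icc (a := (0 : ℝ)) (b := 1)).prod (isCompact_Icc (a := -M) (b := M)))).image
    (by fun_prop : Continuous fun z : ℝ × V2 => (z.1, z.1, z.2)) |>.exists_thickening_subset_open
    (isOpen_lt continuous_const hcont) (by
      rintro _ ⟨⟨s, q⟩, -, rfl⟩
      simpa only [Set.mem_ofPred_eq, htw, h.fderiv_twist_diagonal] using hconv s q.1 q.2)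
  refine ⟨δ, hδ, fun s hs t hst hts q => ?_⟩
  have hcpt (x y : ℝ) (hx : x ∈ Set.Icc (0 : ℝ) 1) (hy : |y| ≤ M) : 0 < tw (s, t, x, y) := by
    have hd (u : ℝ) : HasDerivAt (fun u => tw (s, u, x, y)) (fderiv ℝ tw (s, u, x, y) (0, 1, 0)) u :=
      DifferentiableAt.hasDerivAt_comp_curve (c := fun u => (s, u, x, y))
        (htws.differentiable (by simp) _)
        ((hasDerivAt_const u s).prodMk ((hasDerivAt_id u).prodMk (hasDerivAt_const u (x, y))))
    have hmono := strictMonoOn_of_deriv_pos (convex_Icc s t)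
      (fun u _ => (hd u).continuousAt.continuousWithinAt) (fun u hu => by
        rw [interior_Icc] at hu
        rw [(hd u).deriv]
        refine hsub (Metric.mem_thickening_iff.2
          ⟨(s, s, x, y), ⟨(s, x, y), ⟨hs, hx, abs_le.1 hy⟩, rfl⟩, ?_⟩)
        have : |u - s| < δ := by rw [abs_of_pos (sub_pos.2 hu.1)]; linarith [hu.2]
        simpa [Prod.dist_eq, Real.dist_eq, hδ] using this)
      (Set.left_mem_Icc.2 hst.le) (Set.right_mem_Icc.2 hst.le) hst
    have h0 : tw (s, s, x, y) = 0 := by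
      have : (fun q => (Φ s s q).1) = Prod.fst := funext fun q => by rw [h.flow_self]
      rw [← htwist, this, fderiv_fst]
      simp
    simpa [h0] using hmono
  rcases le_or_gt |q.2| M with hq | hq
  · have hT : Function.Periodic (fun x => fderiv ℝ (fun q => (Φ s t q).1) (x, q.2) (0, 1)) 1 := by
      intro x
      have hshift : (fun q : V2 => (Φ s t (q + (1, 0))).1) = fun q => (Φ s t q).1 + 1 := by
        ext p
        have := congrArg Prod.fst (h.flow_Tmap hper s t p)
        simpa [Tmap, Prod.add_def] using this
      have := fderiv_comp_add_right (𝕜 := ℝ) (f := fun q : V2 => (Φ s t q).1) (x := (x, q.2)) (1, 0)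
      rw [hshift, fderiv_add_const] at this
      simp [this]
    obtain ⟨x, hx, hxq⟩ := hT.exists_mem_Ico₀ one_pos q.1
    have := hcpt x q.2 ⟨hx.1, hx.2.le⟩ hq
    rw [← htwist, ← hxq] at this
    exact this
  · have hev : (fun q => (Φ s t q).1) =ᶠ[𝓝 q] fun q => q.1 + (t - s) * (q.2 / D) := by
      filter_upwards [(continuous_snd.abs.continuousAt (x := q)).eventually_const_lt hq] with p hp
      rw [h.flow_of_quadratic hquad s t hp]
    have hfd := (hasFDerivAt_fst (𝕜 := ℝ) (p := q)).add
      (((hasFDerivAt_snd (𝕜 := ℝ) (p := q)).mul_const D⁻¹).const_mul (t - s))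
    rw [hev.fderiv_eq, show fderiv ℝ (fun q : V2 => q.1 + (t - s) * (q.2 / D)) q = _ from hfd.fderiv]
    simpa using mul_pos (sub_pos.2 hst) (inv_pos.2 hD)

theorem isPosTwistLift (hper : ∀ t x p, H t (x + 1) p = H t x p) {s t : ℝ}
    (htwist : ∀ q, 0 < fderiv ℝ (fun q => (Φ s t q).1) q (0, 1)) : IsPosTwistLift (Φ s t) := by
  refine ⟨(h.contDiff_timeMap s t).of_le (by simp), (h.isHomeomorph s t).bijective, ?_,
    h.flow_Tmap hper s t, ⟨fun τ => Φ s (s + τ * (t - s)), ?_, ?_, ?_,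
      fun τ => ⟨h.isHomeomorph _ _, h.flow_Tmap hper _ _⟩⟩, htwist, h.exists_generating hper s t⟩
  · rw [h.invFun_eq]
    exact (h.contDiff_timeMap t s).of_le (by simp)
  · exact h.contDiff_flow.continuous.comp
      (by fun_prop : Continuous fun q : ℝ × V2 => (s, s + q.1 * (t - s), q.2))
  · ext1 q
    simp [h.flow_self]
  · simp

theorem compFlow_eq (ε : ℕ → ℝ) (n : ℕ) : compFlow Φ ε n = Φ (ε 0) (ε n) := by
  induction n with
  | zero => exact funext fun q => (h.flow_self _ q).symm
  | succ n ih => exact funext fun q => by simp [compFlow, ih, h.flow_flow]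

end IsHamiltonianFlow

/-- the time-1 map of a smooth time- and space-periodic Hamiltonian with
`1/C < ∂²H/∂p² < C` that is quadratic (`p²/2D`) for large `|p|` lies in `𝒫¹`: it is a
finite composition of lifts of positive monotone twist maps, obtained as time-`(εᵢ, εᵢ₊₁)`
maps of the flow for a subdivision `0 = ε₀ < ε₁ < ⋯ < εₙ = 1`. -/
theorem time_one_map_in_P1
    (H : ℝ → ℝ → ℝ → ℝ)
    (hsmooth : ContDiff ℝ (⊤ : ℕ∞) (fun q : ℝ × ℝ × ℝ => H q.1 q.2.1 q.2.2))
    (hpert : ∀ t x p, H (t + 1) x p = H t x p)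
    (hperx : ∀ t x p, H t (x + 1) p = H t x p)
    (C : ℝ) (hC : 0 < C)
    (hconv : ∀ t x p, 1 / C < deriv (deriv (H t x)) p ∧ deriv (deriv (H t x)) p < C)
    (D M : ℝ) (hD : 0 < D) (hM : 0 < M)
    (hquad : ∀ t x p, M ≤ |p| → H t x p = p ^ 2 / (2 * D))
    (Φ : ℝ → ℝ → V2 → V2)
    (hΦsmooth : ContDiff ℝ (⊤ : ℕ∞) (fun q : ℝ × ℝ × V2 => Φ q.1 q.2.1 q.2.2))
    (hΦinit : ∀ s q, Φ s s q = q)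
    (hΦflow : ∀ s q t, HasDerivAt (fun u => Φ s u q)
      (deriv (H t (Φ s t q).1) (Φ s t q).2,
        -(deriv (fun x => H t x (Φ s t q).2) (Φ s t q).1)) t) :
    ∃ n : ℕ, 0 < n ∧ ∃ ε : ℕ → ℝ, ε 0 = 0 ∧ ε n = 1 ∧
      (∀ i < n, ε i < ε (i + 1)) ∧
      (∀ i < n, IsPosTwistLift (Φ (ε i) (ε (i + 1)))) ∧
      Φ 0 1 = compFlow Φ ε n := by
  have h : IsHamiltonianFlow H Φ := ⟨hsmooth, hΦsmooth, hΦinit, hΦflow⟩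
  obtain ⟨δ, hδ, htwist⟩ := h.exists_twist_pos hperx
    (fun t x p => (one_div_pos.2 hC).trans (hconv t x p).1) hD hquad
  obtain ⟨n, hn⟩ := exists_nat_one_div_lt hδ
  have hn0 : (0 : ℝ) < n + 1 := n.cast_add_one_pos
  have hstep (i : ℕ) : ((i + 1 : ℕ) : ℝ) / (n + 1) = i / (n + 1) + 1 / (n + 1) := by
    push_cast
    ring
  have hpos : (0 : ℝ) < 1 / (n + 1) := one_div_pos.2 hn0
  refine ⟨n + 1, n.succ_pos, fun i => i / (n + 1), by simp, by simp [hn0.ne'], fun i _ => ?_,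
    fun i hi => h.isPosTwistLift hperx (htwist _ ⟨by positivity, ?_⟩ _ ?_ ?_), ?_⟩
  · simpa only [hstep] using lt_add_of_pos_right _ hpos
  · rw [div_le_one hn0]
    exact_mod_cast hi.le
  · simpa only [hstep] using lt_add_of_pos_right _ hpos
  · simpa only [hstep] using add_lt_add_right hn _
  · rw [h.compFlow_eq]
    simp [hn0.ne']
end
end

section
/- Let L : ℝ × ℝ × ℝ → ℝ be smooth, 1-periodic in the first (time) and second (position) variables, with ∂²L/∂r² > 0 everywhere, and such that L(t, x, r) = (D/2)r² whenever |r| ≥ M, for some constants D > 0 and M > 0. Then the Euler–Lagrange flow of L is complete: for every (a, b, h) ∈ ℝ³ there exists a C² function θ : ℝ → ℝ, defined on all of ℝ, with θ(a) = b, θ'(a) = h, satisfying the Euler–Lagrange equation (d/dt)(∂_r L(t, θ(t), θ'(t))) = ∂_x L(t, θ(t), θ'(t)) for all t ∈ ℝ; moreover any Euler–Lagrange solution with |θ'(t)| ≥ M on an interval is affine there. -/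
open Filter Topology

noncomputable section

/-- `θ` is a (global) Euler–Lagrange solution of the time-dependent Lagrangian `L(t,x,r)`:
`θ` is C² and `(d/dt)(∂_r L(t, θ, θ')) = ∂_x L(t, θ, θ')` for all `t`. -/
def IsELSolution (L : ℝ → ℝ → ℝ → ℝ) (θ : ℝ → ℝ) : Prop :=
  ContDiff ℝ 2 θ ∧
  ∀ t, HasDerivAt (fun s => deriv (fun r => L s (θ s) r) (deriv θ s))
    (deriv (fun x => L t x (deriv θ t)) (θ t)) t

open Set Metric
open scoped Manifold NNReal

/-- A `C¹` globally Lipschitz vector field on a Banach space is complete. -/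
theorem exists_isIntegralCurve_of_lipschitzWith {E : Type*} [NormedAddCommGroup E]
    [NormedSpace ℝ E] [CompleteSpace E] {v : E → E} {K : ℝ≥0} (hv : ContDiff ℝ 1 v)
    (hK : LipschitzWith K v) (x : E) :
    ∃ γ : ℝ → E, γ 0 = x ∧ ∀ t, HasDerivAt γ (v (γ t)) t := by
  have hε : (0 : ℝ) < 1 / (1 + K) := by positivity
  have hlocal : ∀ y : E, ∃ γ : ℝ → E, γ 0 = y ∧
      ∀ t ∈ Icc (-(1 / (1 + K) : ℝ)) (1 / (1 + K)),
        HasDerivWithinAt γ (v (γ t)) (Icc (-(1 / (1 + K) : ℝ)) (1 / (1 + K))) t := by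
    intro y
    have hpl : IsPicardLindelof (fun _ ↦ v) (tmin := -(1 / (1 + K) : ℝ)) (tmax := 1 / (1 + K))
        ⟨0, by constructor <;> linarith⟩ y (‖v y‖₊ + 1) 0 (‖v y‖₊ + K * (‖v y‖₊ + 1)) K := by
      refine .of_time_independent (fun z hz ↦ ?_) hK.lipschitzOnWith ?_
      · have hd := hK.norm_sub_le z y
        rw [mem_closedBall_iff_norm] at hz
        push_cast at hz ⊢
        calc ‖v z‖ ≤ ‖v y‖ + ‖v z - v y‖ := norm_le_norm_add_norm_sub' _ _
          _ ≤ ‖v y‖ + K * (‖v y‖ + 1) := by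
            gcongr
            exact hd.trans (by gcongr)
      · push_cast
        simp only [sub_zero, zero_sub, neg_neg, max_self]
        rw [mul_one_div, div_le_iff₀ (by positivity)]
        nlinarith [norm_nonneg (v y), K.coe_nonneg]
    exact hpl.exists_eq_forall_mem_Icc_hasDerivWithinAt₀
  obtain ⟨γ, hγ, hγ'⟩ := exists_isMIntegralCurve_of_isMIntegralCurveOn (I := 𝓘(ℝ, E)) (M := E)
    (v := v) (contMDiff_vectorSpace_iff_contDiff.2 hv) hε (fun y ↦ by
      obtain ⟨γ, hγ, hγ'⟩ := hlocal y
      refine ⟨γ, hγ, fun t ht ↦ HasFDerivWithinAt.hasMFDerivWithinAt ?_⟩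
      exact ((hγ' t (Ioo_subset_Icc_self ht)).mono Ioo_subset_Icc_self).hasFDerivWithinAt) x
  exact ⟨γ, hγ, fun t ↦ by
    have h : HasFDerivAt γ ((1 : ℝ →L[ℝ] ℝ).smulRight (v (γ t))) t := (hγ' t).hasFDerivAt
    simpa using h.hasDerivAt⟩

/-- The derivative of a periodic function is periodic. -/
theorem Function.Periodic.fderiv {E F : Type*} [NormedAddCommGroup E] [NormedSpace ℝ E]
    [NormedAddCommGroup F] [NormedSpace ℝ F] {G : E → F} {e : E} (h : Function.Periodic G e) :
    Function.Periodic (fderiv ℝ G) e := by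
  intro q
  rw [← fderiv_comp_add_right, funext h]

theorem eventually_lt_abs_velocity {M : ℝ} {q : ℝ × ℝ × ℝ} (hq : M < |q.2.2|) :
    ∀ᶠ p : ℝ × ℝ × ℝ in 𝓝 q, M < |p.2.2| :=
  (isOpen_lt continuous_const
    (continuous_abs.comp (continuous_snd.comp continuous_snd))).mem_nhds hq

/-- A `C¹` function of `(t, x, r)` that is `1`-periodic in `t` and `x` and vanishes for large `r`
is globally Lipschitz. -/
theorem exists_lipschitzWith_of_periodic {G : ℝ × ℝ × ℝ → ℝ} (hG : ContDiff ℝ 1 G)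
    (h₁ : Function.Periodic G (1, 0, 0)) (h₂ : Function.Periodic G (0, 1, 0)) {M : ℝ}
    (hM : ∀ q : ℝ × ℝ × ℝ, M < |q.2.2| → G q = 0) : ∃ K, LipschitzWith K G := by
  have hcont : Continuous (fun q ↦ ‖fderiv ℝ G q‖₊) := (hG.continuous_fderiv one_ne_zero).nnnorm
  obtain ⟨K, hK⟩ := (((isCompact_Icc (a := (0 : ℝ)) (b := 1)).prod
    ((isCompact_Icc (a := (0 : ℝ)) (b := 1)).prod
      (isCompact_Icc (a := -M) (b := M)))).image hcont).bddAbove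
  refine ⟨K, lipschitzWith_of_nnnorm_fderiv_le (hG.differentiable one_ne_zero) fun q ↦ ?_⟩
  rcases lt_or_ge M |q.2.2| with hq | hq
  · have hev : G =ᶠ[𝓝 q] fun _ ↦ 0 :=
      (eventually_lt_abs_velocity hq).mono hM
    rw [hev.fderiv_eq]
    simp
  · have hred : fderiv ℝ G q = fderiv ℝ G (Int.fract q.1, Int.fract q.2.1, q.2.2) := by
      rw [← h₁.fderiv.sub_zsmul_eq ⌊q.1⌋, ← h₂.fderiv.sub_zsmul_eq ⌊q.2.1⌋]
      congr 1
      ext <;> simp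
    rw [hred]
    refine hK ⟨_, ⟨?_, ?_, ?_⟩, rfl⟩
    · exact ⟨Int.fract_nonneg _, (Int.fract_lt_one _).le⟩
    · exact ⟨Int.fract_nonneg _, (Int.fract_lt_one _).le⟩
    · exact abs_le.1 hq

/-- The projection `(t, x, r) ↦ r` as a continuous linear map. -/
def velocityProj : ℝ × ℝ × ℝ →L[ℝ] ℝ :=
  (ContinuousLinearMap.snd ℝ ℝ ℝ).comp (ContinuousLinearMap.snd ℝ ℝ (ℝ × ℝ))

@[simp]
theorem velocityProj_apply (q : ℝ × ℝ × ℝ) : velocityProj q = q.2.2 := rfl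

/-- The momentum `∂F/∂r` of a Lagrangian `F(t, x, r)`. -/
def momentum (F : ℝ × ℝ × ℝ → ℝ) (q : ℝ × ℝ × ℝ) : ℝ := fderiv ℝ F q (0, 0, 1)

/-- The acceleration `(∂ₓF - ∂ₜ∂ᵣF - r ∂ₓ∂ᵣF) / ∂ᵣ²F` prescribed by the Euler–Lagrange equation. -/
def acceleration (F : ℝ × ℝ × ℝ → ℝ) (q : ℝ × ℝ × ℝ) : ℝ :=
  (fderiv ℝ F q (0, 1, 0) - fderiv ℝ (momentum F) q (1, 0, 0)
    - q.2.2 * fderiv ℝ (momentum F) q (0, 1, 0)) / fderiv ℝ (momentum F) q (0, 0, 1)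

section

variable {F : ℝ × ℝ × ℝ → ℝ}

theorem deriv_velocity (hF : Differentiable ℝ F) (t x r : ℝ) :
    deriv (fun s ↦ F (t, x, s)) r = fderiv ℝ F (t, x, r) (0, 0, 1) :=
  ((hF _).hasFDerivAt.comp_hasDerivAt r
    ((hasDerivAt_const r t).prodMk ((hasDerivAt_const r x).prodMk (hasDerivAt_id r)))).deriv

theorem deriv_position (hF : Differentiable ℝ F) (t x r : ℝ) :
    deriv (fun y ↦ F (t, y, r)) x = fderiv ℝ F (t, x, r) (0, 1, 0) :=
  ((hF _).hasFDerivAt.comp_hasDerivAt x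
    ((hasDerivAt_const x t).prodMk ((hasDerivAt_id x).prodMk (hasDerivAt_const x r)))).deriv

theorem contDiff_momentum (hF : ContDiff ℝ (⊤ : ℕ∞) F) : ContDiff ℝ (⊤ : ℕ∞) (momentum F) :=
  (hF.fderiv_right (m := ((⊤ : ℕ∞) : WithTop ℕ∞)) (by simp)).clm_apply contDiff_const

theorem contDiff_acceleration (hF : ContDiff ℝ (⊤ : ℕ∞) F)
    (hconv : ∀ q, fderiv ℝ (momentum F) q (0, 0, 1) ≠ 0) :
    ContDiff ℝ 1 (acceleration F) := by
  have hdF : ContDiff ℝ 1 (fderiv ℝ F) :=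
    (contDiff_infty.1 hF 2).fderiv_right one_add_one_eq_two.le
  have hdP : ContDiff ℝ 1 (fderiv ℝ (momentum F)) :=
    (contDiff_infty.1 (contDiff_momentum hF) 2).fderiv_right one_add_one_eq_two.le
  unfold acceleration
  exact (((hdF.clm_apply contDiff_const).sub (hdP.clm_apply contDiff_const)).sub
    ((contDiff_snd.comp contDiff_snd).mul (hdP.clm_apply contDiff_const))).div
    (hdP.clm_apply contDiff_const) hconv

theorem Function.Periodic.momentum {e : ℝ × ℝ × ℝ} (h : Function.Periodic F e) :
    Function.Periodic (momentum F) e := fun q ↦ by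
  simp only [_root_.momentum, h.fderiv q]

theorem Function.Periodic.acceleration {e : ℝ × ℝ × ℝ} (h : Function.Periodic F e)
    (he : e.2.2 = 0) : Function.Periodic (acceleration F) e := fun q ↦ by
  simp only [_root_.acceleration, h.fderiv q, h.momentum.fderiv q, Prod.snd_add, he, add_zero]

variable {D M : ℝ}

theorem hasFDerivAt_of_quadratic (hquad : ∀ q : ℝ × ℝ × ℝ, M ≤ |q.2.2| → F q = D / 2 * q.2.2 ^ 2)
    {q : ℝ × ℝ × ℝ} (hq : M < |q.2.2|) : HasFDerivAt F ((D * q.2.2) • velocityProj) q := by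
  have h : HasFDerivAt (fun p : ℝ × ℝ × ℝ ↦ D / 2 * p.2.2 ^ 2)
      ((D / 2) • ((2 * q.2.2 ^ 1) • velocityProj)) q := by
    simpa using! (velocityProj.hasFDerivAt (x := q)).pow 2 |>.const_mul (D / 2)
  have h' := h.congr_of_eventuallyEq
    ((eventually_lt_abs_velocity hq).mono fun p hp ↦ hquad p hp.le)
  convert h' using 1
  rw [smul_smul]
  congr 1
  ring

theorem momentum_eq_of_lt (hquad : ∀ q : ℝ × ℝ × ℝ, M ≤ |q.2.2| → F q = D / 2 * q.2.2 ^ 2)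
    {q : ℝ × ℝ × ℝ} (hq : M < |q.2.2|) : momentum F q = D * q.2.2 := by
  simp [momentum, (hasFDerivAt_of_quadratic hquad hq).fderiv]

theorem momentum_eq_of_le (hF : ContDiff ℝ (⊤ : ℕ∞) F)
    (hquad : ∀ q : ℝ × ℝ × ℝ, M ≤ |q.2.2| → F q = D / 2 * q.2.2 ^ 2)
    {t x r : ℝ} (hr : M ≤ |r|) : momentum F (t, x, r) = D * r := by
  have hclosed : IsClosed {s : ℝ | momentum F (t, x, s) = D * s} :=
    isClosed_eq ((contDiff_momentum hF).continuous.comp (by fun_prop)) (by fun_prop)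
  rcases le_abs.1 hr with h | h
  · have hsub : closure (Ioi M) ⊆ {s : ℝ | momentum F (t, x, s) = D * s} :=
      closure_minimal (fun s hs ↦ momentum_eq_of_lt hquad (lt_abs.2 (Or.inl hs))) hclosed
    rw [closure_Ioi] at hsub
    exact hsub h
  · have hsub : closure (Iio (-M)) ⊆ {s : ℝ | momentum F (t, x, s) = D * s} :=
      closure_minimal (fun s hs ↦ momentum_eq_of_lt hquad
        (lt_abs.2 (Or.inr (lt_neg_of_lt_neg hs)))) hclosed
    rw [closure_Iio] at hsub
    exact hsub (le_neg_of_le_neg h)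

theorem acceleration_eq_zero (hquad : ∀ q : ℝ × ℝ × ℝ, M ≤ |q.2.2| → F q = D / 2 * q.2.2 ^ 2)
    {q : ℝ × ℝ × ℝ} (hq : M < |q.2.2|) : acceleration F q = 0 := by
  have hP : HasFDerivAt (momentum F) (D • velocityProj) q :=
    ((velocityProj.hasFDerivAt (x := q)).const_mul D).congr_of_eventuallyEq
      ((eventually_lt_abs_velocity hq).mono fun p hp ↦ momentum_eq_of_lt hquad hp)
  simp [acceleration, (hasFDerivAt_of_quadratic hquad hq).fderiv, hP.fderiv]

/-- A globally Lipschitz `C¹` second-order equation `θ'' = f(t, θ, θ')` has global solutions. -/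
theorem exists_global_solution_second_order {f : ℝ × ℝ × ℝ → ℝ} {K : ℝ≥0} (hf : ContDiff ℝ 1 f)
    (hK : LipschitzWith K f) (a b h : ℝ) :
    ∃ θ ω : ℝ → ℝ, θ a = b ∧ ω a = h ∧ (∀ t, HasDerivAt θ (ω t) t) ∧
      ∀ t, HasDerivAt ω (f (t, θ t, ω t)) t := by
  obtain ⟨γ, hγ₀, hγ⟩ := exists_isIntegralCurve_of_lipschitzWith
    (v := fun q : ℝ × ℝ × ℝ ↦ ((1 : ℝ), q.2.2, f q))
    (contDiff_const.prodMk ((contDiff_snd.comp contDiff_snd).prodMk hf))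
    ((LipschitzWith.const (1 : ℝ)).prodMk
      ((LipschitzWith.prod_snd.comp LipschitzWith.prod_snd).prodMk hK)) (a, b, h)
  have h₁ : ∀ t, HasDerivAt (fun s ↦ (γ s).1) 1 t := fun t ↦
    (hγ t).fst
  have h₂ : ∀ t, HasDerivAt (fun s ↦ (γ s).2.1) (γ t).2.2 t := fun t ↦
    (hγ t).snd.fst
  have h₃ : ∀ t, HasDerivAt (fun s ↦ (γ s).2.2) (f (γ t)) t := fun t ↦
    (hγ t).snd.snd
  have htime : ∀ t, (γ t).1 = a + t := by
    have hd : ∀ t, HasDerivAt (fun s ↦ (γ s).1 - s) 0 t := fun t ↦ by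
      simpa using! (h₁ t).sub (hasDerivAt_id t)
    intro t
    have := is_const_of_deriv_eq_zero (fun t ↦ (hd t).differentiableAt) (fun t ↦ (hd t).deriv) t 0
    simp only [hγ₀, sub_zero] at this
    linarith
  refine ⟨fun t ↦ (γ (t - a)).2.1, fun t ↦ (γ (t - a)).2.2, by simp [hγ₀], by simp [hγ₀],
    fun t ↦ (h₂ (t - a)).comp_sub_const t a, fun t ↦ ?_⟩
  have hpt : (t, (γ (t - a)).2.1, (γ (t - a)).2.2) = γ (t - a) := by
    ext <;> simp [htime]
  rw [hpt]
  exact (h₃ (t - a)).comp_sub_const t a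

/-- Along a solution of the second-order equation, the momentum satisfies the Euler–Lagrange
equation. -/
theorem hasDerivAt_momentum (hF : ContDiff ℝ (⊤ : ℕ∞) F)
    (hconv : ∀ q, fderiv ℝ (momentum F) q (0, 0, 1) ≠ 0) {θ ω : ℝ → ℝ} {t : ℝ}
    (hθ : HasDerivAt θ (ω t) t) (hω : HasDerivAt ω (acceleration F (t, θ t, ω t)) t) :
    HasDerivAt (fun s ↦ momentum F (s, θ s, ω s)) (fderiv ℝ F (t, θ t, ω t) (0, 1, 0)) t := by
  have hP := ((contDiff_momentum hF).differentiable (by simp) (t, θ t, ω t)).hasFDerivAt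
  have hcomp := hP.comp_hasDerivAt t ((hasDerivAt_id t).prodMk (hθ.prodMk hω))
  refine hcomp.congr_deriv ?_
  have hsplit : ((1 : ℝ), ω t, acceleration F (t, θ t, ω t)) = (1, 0, 0) + ω t • (0, 1, 0)
      + acceleration F (t, θ t, ω t) • ((0 : ℝ), (0 : ℝ), (1 : ℝ)) := by
    ext <;> simp
  rw [hsplit, map_add, map_add, map_smul, map_smul]
  simp only [smul_eq_mul]
  rw [acceleration, div_mul_cancel₀ _ (hconv _)]
  ring

end

/-- a smooth time- and space-periodic Lagrangian with `∂²L/∂r² > 0` that is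
quadratic (`(D/2)r²`) for `|r| ≥ M` has complete Euler–Lagrange flow, and any solution
with `|θ'| ≥ M` on an interval is affine there. -/
theorem euler_lagrange_flow_complete
    (L : ℝ → ℝ → ℝ → ℝ)
    (hsmooth : ContDiff ℝ (⊤ : ℕ∞) (fun q : ℝ × ℝ × ℝ => L q.1 q.2.1 q.2.2))
    (hpert : ∀ t x r, L (t + 1) x r = L t x r)
    (hperx : ∀ t x r, L t (x + 1) r = L t x r)
    (hconv : ∀ t x r, 0 < deriv (deriv (L t x)) r)
    (D M : ℝ) (hD : 0 < D) (hM : 0 < M)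
    (hquad : ∀ t x r, M ≤ |r| → L t x r = D / 2 * r ^ 2) :
    (∀ a b h : ℝ, ∃ θ : ℝ → ℝ, IsELSolution L θ ∧ θ a = b ∧ deriv θ a = h) ∧
    (∀ θ : ℝ → ℝ, IsELSolution L θ → ∀ s t : ℝ, s < t →
      (∀ u ∈ Set.Icc s t, M ≤ |deriv θ u|) →
      ∀ u ∈ Set.Icc s t, θ u = θ s + deriv θ s * (u - s)) := by
  set F : ℝ × ℝ × ℝ → ℝ := fun q ↦ L q.1 q.2.1 q.2.2 with hFdef
  have hF : ContDiff ℝ (⊤ : ℕ∞) F := hsmooth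
  have hFd : Differentiable ℝ F := hF.differentiable (by simp)
  have hPd : Differentiable ℝ (momentum F) := (contDiff_momentum hF).differentiable (by simp)
  have hmom : ∀ t x r, deriv (fun s ↦ L t x s) r = momentum F (t, x, r) := deriv_velocity hFd
  have hforce : ∀ t x r, deriv (fun y ↦ L t y r) x = fderiv ℝ F (t, x, r) (0, 1, 0) :=
    deriv_position hFd
  have hne : ∀ q, fderiv ℝ (momentum F) q (0, 0, 1) ≠ 0 := by
    rintro ⟨t, x, r⟩
    rw [← deriv_velocity hPd, ← funext (hmom t x)]
    exact (hconv t x r).ne'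
  have hq : ∀ q : ℝ × ℝ × ℝ, M ≤ |q.2.2| → F q = D / 2 * q.2.2 ^ 2 := fun q ↦ hquad _ _ _
  have hp₁ : Function.Periodic F (1, 0, 0) := fun q ↦ by simp [hFdef, hpert]
  have hp₂ : Function.Periodic F (0, 1, 0) := fun q ↦ by simp [hFdef, hperx]
  have hacc := contDiff_acceleration hF hne
  refine ⟨fun a b h ↦ ?_, fun θ hθ s t hst hbig u hu ↦ ?_⟩
  · obtain ⟨K, hK⟩ := exists_lipschitzWith_of_periodic hacc (hp₁.acceleration rfl)
      (hp₂.acceleration rfl) (fun q ↦ acceleration_eq_zero hq)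
    obtain ⟨θ, ω, hθa, hωa, hθ, hω⟩ := exists_global_solution_second_order hacc hK a b h
    have hderiv : deriv θ = ω := funext fun t ↦ (hθ t).deriv
    have hθc : Continuous θ := continuous_iff_continuousAt.2 fun t ↦ (hθ t).continuousAt
    have hωc : Continuous ω := continuous_iff_continuousAt.2 fun t ↦ (hω t).continuousAt
    refine ⟨θ, ⟨?_, fun t ↦ ?_⟩, hθa, by rw [hderiv, hωa]⟩
    · have hω₁ : ContDiff ℝ 1 ω := by
        rw [contDiff_one_iff_deriv]
        refine ⟨fun t ↦ (hω t).differentiableAt, ?_⟩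
        rw [funext fun t ↦ (hω t).deriv]
        exact hacc.continuous.comp (by fun_prop)
      rw [show (2 : WithTop ℕ∞) = 1 + 1 from one_add_one_eq_two.symm, contDiff_succ_iff_deriv]
      exact ⟨fun t ↦ (hθ t).differentiableAt, by simp, hderiv ▸ hω₁⟩
    · simp only [hmom, hforce, hderiv]
      exact hasDerivAt_momentum hF hne (hθ t) (hω t)
  · have hconst : ∀ v ∈ Icc s t, deriv θ v = deriv θ s := by
      have hder : ∀ v ∈ Icc s t, HasDerivWithinAt (fun w ↦ D * deriv θ w) 0 (Icc s t) v := by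
        intro v hv
        have hzero : deriv (fun x ↦ L v x (deriv θ v)) (θ v) = 0 := by
          simp [hquad _ _ _ (hbig v hv)]
        have h := (hθ.2 v).hasDerivWithinAt (s := Icc s t)
        rw [hzero] at h
        have heq : ∀ w ∈ Icc s t,
            D * deriv θ w = deriv (fun r ↦ L w (θ w) r) (deriv θ w) := fun w hw ↦ by
          rw [hmom, momentum_eq_of_le hF hq (hbig w hw)]
        exact h.congr heq (heq v hv)
      intro v hv
      have h := constant_of_has_deriv_right_zero (fun w hw ↦ (hder w hw).continuousWithinAt)
        (fun w hw ↦ ((hder w (Ico_subset_Icc_self hw)).mono_of_mem_nhdsWithin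
          (Icc_mem_nhdsGE_of_mem hw))) v hv
      exact mul_left_cancel₀ hD.ne' h
    have hθd : Differentiable ℝ θ := hθ.1.differentiable (by norm_num)
    have hder : ∀ v ∈ Icc s t,
        HasDerivAt (fun w ↦ θ w - deriv θ s * (w - s)) 0 v := fun v hv ↦ by
      have h := (hθd v).hasDerivAt.sub (((hasDerivAt_id v).sub_const s).const_mul (deriv θ s))
      simpa [hconst v hv] using! h
    have h := constant_of_has_deriv_right_zero
      (fun w hw ↦ (hder w hw).continuousAt.continuousWithinAt)
      (fun w hw ↦ (hder w (Ico_subset_Icc_self hw)).hasDerivWithinAt) u hu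
    simp only [sub_self, mul_zero, sub_zero] at h
    linarith
end
end
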